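/- arXiv:1402.1292 — 2 statements merged into one kernel-verified Lean document; each statement's English description precedes it below -/
import Mathlib

section
/- Let L be a field of characteristic different from 2. For n ≥ 1 let N_n ∈ M_n(L) be the matrix with (N_n)_{i,j} = 1 if i = j−1 and (N_n)_{i,j} = 0 otherwise. Let l ≥ 0 and let m_1, …, m_l ≥ 0 be integers, and let N = diag(N_1, …, N_1, …, N_l, …, N_l) be the block-diagonal matrix in which each block N_n is repeated m_n times. Then there exists an invertible symmetric matrix A (i.e. Aᵀ = A) over L with A·N = −Nᵀ·A if and only if m_n is even for every even n with 1 ≤ n ≤ l. -/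
open Matrix

/-- The `k × k` Jordan nilpotent block `N_k` over `L`, with entries
`(N_k)_{i,j} = 1` if `i = j - 1` (i.e. `i + 1 = j`) and `0` otherwise. -/
def jordanNilBlock (L : Type*) [Zero L] [One L] (k : ℕ) : Matrix (Fin k) (Fin k) L :=
  fun i j => if (i : ℕ) + 1 = (j : ℕ) then 1 else 0

/-- The block-diagonal matrix `N = N(m_1, …, m_l)` in which, for each `1 ≤ n ≤ l`,
the Jordan block `N_n` is repeated `m_n` times (the index `p : Fin l` corresponds
to the block size `p + 1`). -/
def jordanNilMatrix (L : Type*) [Zero L] [One L] (l : ℕ) (m : Fin l → ℕ) :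
    Matrix (Σ p : Σ n : Fin l, Fin (m n), Fin ((p.1 : ℕ) + 1))
           (Σ p : Σ n : Fin l, Fin (m n), Fin ((p.1 : ℕ) + 1)) L :=
  Matrix.blockDiagonal' fun p : Σ n : Fin l, Fin (m n) =>
    jordanNilBlock L ((p.1 : ℕ) + 1)

section JordanBlocks

variable {L : Type*} [Field L] {ι : Type*} [DecidableEq ι] {d : ι → ℕ}

theorem blockDiagonal'_jordanNilBlock_apply (x y : Σ p, Fin (d p)) :
    blockDiagonal' (fun p => jordanNilBlock L (d p)) x y =
      if x.1 = y.1 ∧ (x.2 : ℕ) + 1 = y.2 then 1 else 0 := by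
  obtain ⟨p, i⟩ := x
  obtain ⟨q, j⟩ := y
  by_cases h : p = q
  · subst h
    simp [jordanNilBlock]
  · simp [blockDiagonal'_apply_ne _ _ _ h, h]

variable [Fintype ι] (A : Matrix (Σ p, Fin (d p)) (Σ p, Fin (d p)) L)

theorem mul_blockDiagonal'_jordanNilBlock_succ (x : Σ p, Fin (d p)) (q : ι) (j : ℕ)
    (hj : j + 1 < d q) :
    (A * blockDiagonal' fun p => jordanNilBlock L (d p)) x ⟨q, j + 1, hj⟩ =
      A x ⟨q, j, by omega⟩ := by
  rw [mul_apply, Finset.sum_eq_single ⟨q, j, by omega⟩]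
  · rw [blockDiagonal'_jordanNilBlock_apply]
    simp
  · rintro ⟨p, i⟩ - hne
    rw [blockDiagonal'_jordanNilBlock_apply, if_neg, mul_zero]
    rintro ⟨h₁, h₂⟩
    dsimp only at h₁ h₂
    subst h₁
    exact hne (by congr; ext; simpa using h₂)
  · simp

theorem mul_blockDiagonal'_jordanNilBlock_zero (x : Σ p, Fin (d p)) (q : ι) (hq : 0 < d q) :
    (A * blockDiagonal' fun p => jordanNilBlock L (d p)) x ⟨q, 0, hq⟩ = 0 := by
  simp [mul_apply, blockDiagonal'_jordanNilBlock_apply]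

theorem blockDiagonal'_jordanNilBlock_mul_of_lt (y : Σ p, Fin (d p)) (p : ι) (i : ℕ)
    (hi : i + 1 < d p) :
    ((blockDiagonal' fun p => jordanNilBlock L (d p)) * A) ⟨p, i, by omega⟩ y =
      A ⟨p, i + 1, hi⟩ y := by
  rw [mul_apply, Finset.sum_eq_single ⟨p, i + 1, hi⟩]
  · rw [blockDiagonal'_jordanNilBlock_apply]
    simp
  · rintro ⟨q, j⟩ - hne
    rw [blockDiagonal'_jordanNilBlock_apply, if_neg, zero_mul]
    rintro ⟨h₁, h₂⟩
    dsimp only at h₁ h₂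
    subst h₁
    exact hne (by congr; ext; simpa using h₂.symm)
  · simp

theorem blockDiagonal'_jordanNilBlock_mul_last (y : Σ p, Fin (d p)) (p : ι) (i : ℕ)
    (hi : i + 1 = d p) :
    ((blockDiagonal' fun p => jordanNilBlock L (d p)) * A) ⟨p, i, by omega⟩ y = 0 := by
  rw [mul_apply]
  refine Finset.sum_eq_zero ?_
  rintro ⟨q, j⟩ -
  rw [blockDiagonal'_jordanNilBlock_apply, if_neg, zero_mul]
  rintro ⟨h₁, h₂⟩
  dsimp only at h₁ h₂
  subst h₁
  have := j.2
  omega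

variable {A}

omit [DecidableEq ι] [Fintype ι] in
theorem apply_add_eq_of_apply_succ_eq_neg
    (h : ∀ (p q : ι) (i j : ℕ) (hi : i + 1 < d p) (hj : j + 1 < d q),
      A ⟨p, i + 1, hi⟩ ⟨q, j, by omega⟩ = -A ⟨p, i, by omega⟩ ⟨q, j + 1, hj⟩)
    (p q : ι) (k j : ℕ) (hi : k < d p) (hj : j + k < d q) :
    A ⟨p, k, hi⟩ ⟨q, j, by omega⟩ = (-1) ^ k * A ⟨p, 0, by omega⟩ ⟨q, j + k, hj⟩ := by
  induction k generalizing j with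
  | zero => simp
  | succ k ih =>
    rw [h p q k j hi (by omega), ih (j + 1) (by omega) (by omega)]
    have : (⟨j + 1 + k, by omega⟩ : Fin (d q)) = ⟨j + (k + 1), hj⟩ := by ext; simp; omega
    rw [this, pow_succ]
    ring

section Anticommuting

variable (hA : A * (blockDiagonal' fun p => jordanNilBlock L (d p)) =
  -((blockDiagonal' fun p => jordanNilBlock L (d p))ᵀ * A))

include hA

theorem apply_succ_eq_neg_of_anticommuting (p q : ι) (i j : ℕ) (hi : i + 1 < d p)
    (hj : j + 1 < d q) :
    A ⟨p, i + 1, hi⟩ ⟨q, j, by omega⟩ = -A ⟨p, i, by omega⟩ ⟨q, j + 1, hj⟩ := by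
  have h := congrFun₂ hA ⟨p, i + 1, hi⟩ ⟨q, j + 1, hj⟩
  rw [mul_blockDiagonal'_jordanNilBlock_succ, neg_apply, ← transpose_transpose A,
    ← transpose_mul, transpose_apply (_ * _), mul_blockDiagonal'_jordanNilBlock_succ] at h
  simpa using h

theorem apply_zero_eq_zero_of_anticommuting (p q : ι) (j : ℕ) (hp : 0 < d p)
    (hj : j + 1 < d q) : A ⟨p, 0, hp⟩ ⟨q, j, by omega⟩ = 0 := by
  have h := congrFun₂ hA ⟨p, 0, hp⟩ ⟨q, j + 1, hj⟩
  rw [mul_blockDiagonal'_jordanNilBlock_succ, neg_apply, ← transpose_transpose A,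
    ← transpose_mul, transpose_apply (_ * _), mul_blockDiagonal'_jordanNilBlock_zero] at h
  simpa using h

theorem apply_eq_neg_one_pow_mul_of_anticommuting (p q : ι) (k : ℕ) (hp : k < d p)
    (hq : k < d q) :
    A ⟨p, k, hp⟩ ⟨q, 0, by omega⟩ = (-1) ^ k * A ⟨p, 0, by omega⟩ ⟨q, k, hq⟩ := by
  simpa using apply_add_eq_of_apply_succ_eq_neg (apply_succ_eq_neg_of_anticommuting hA)
    p q k 0 hp (by omega)

theorem apply_eq_zero_of_anticommuting (hs : Aᵀ = A) (p q : ι) (k : ℕ) (hp : k < d p)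
    (hq : 0 < d q) (hk : k + 1 < d p ∨ k + 1 < d q) : A ⟨p, k, hp⟩ ⟨q, 0, hq⟩ = 0 := by
  by_cases h : k + 1 < d p
  · rw [← hs, transpose_apply]
    exact apply_zero_eq_zero_of_anticommuting hA q p k hq h
  · have h' : k + 1 < d q := by omega
    rw [apply_eq_neg_one_pow_mul_of_anticommuting hA p q k hp (by omega),
      apply_zero_eq_zero_of_anticommuting hA p q k (by omega) h', mul_zero]

end Anticommuting

theorem apply_zero_eq_zero_of_mul_eq_neg_mul_transpose
    (hA : (blockDiagonal' fun p => jordanNilBlock L (d p)) * A =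
      -(A * (blockDiagonal' fun p => jordanNilBlock L (d p))ᵀ))
    (p q : ι) (j : ℕ) (hp : 0 < d p) (hj : j < d q) (hpj : d p ≤ j) :
    A ⟨p, 0, hp⟩ ⟨q, j, hj⟩ = 0 := by
  have hsucc : ∀ (p q : ι) (i j : ℕ) (hi : i + 1 < d p) (hj : j + 1 < d q),
      A ⟨p, i + 1, hi⟩ ⟨q, j, by omega⟩ = -A ⟨p, i, by omega⟩ ⟨q, j + 1, hj⟩ := by
    intro p q i j hi hj
    have h := congrFun₂ hA ⟨p, i, by omega⟩ ⟨q, j, by omega⟩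
    rw [blockDiagonal'_jordanNilBlock_mul_of_lt _ _ _ _ hi, neg_apply, ← transpose_transpose A,
      ← transpose_mul, transpose_apply (_ * _),
      blockDiagonal'_jordanNilBlock_mul_of_lt _ _ _ _ hj] at h
    simpa using h
  have hlast : A ⟨p, d p - 1, by omega⟩ ⟨q, j - d p + 1, by omega⟩ = 0 := by
    have h := congrFun₂ hA ⟨p, d p - 1, by omega⟩ ⟨q, j - d p, by omega⟩
    rw [blockDiagonal'_jordanNilBlock_mul_last _ _ _ _ (by omega), neg_apply,
      ← transpose_transpose A, ← transpose_mul, transpose_apply (_ * _),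
      blockDiagonal'_jordanNilBlock_mul_of_lt _ _ _ _ (by omega)] at h
    simpa using h
  rw [apply_add_eq_of_apply_succ_eq_neg hsucc p q _ _ _ (by omega)] at hlast
  have : (⟨j - d p + 1 + (d p - 1), by omega⟩ : Fin (d q)) = ⟨j, hj⟩ := by ext; simp; omega
  rw [this] at hlast
  exact (mul_eq_zero.mp hlast).resolve_left (pow_ne_zero _ (by simp))

end JordanBlocks

theorem even_card_of_isUnit_of_transpose_eq_neg {L : Type*} [Field L] (hchar : ringChar L ≠ 2)
    {ι : Type*} [Fintype ι] [DecidableEq ι] (B : Matrix ι ι L) (hB : IsUnit B)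
    (hs : Bᵀ = -B) : Even (Fintype.card ι) := by
  by_contra hodd
  have h : B.det = -B.det := by
    conv_lhs => rw [← det_transpose, hs, det_neg, (Nat.not_even_iff_odd.mp hodd).neg_one_pow]
    ring
  have h2 : (2 : L) * B.det = 0 := by linear_combination h
  exact mul_ne_zero (Ring.two_ne_zero hchar) ((isUnit_iff_isUnit_det B).mp hB).ne_zero h2

theorem even_of_anticommuting {L : Type*} [Field L] (hchar : ringChar L ≠ 2) {l : ℕ}
    {m : Fin l → ℕ}
    {A : Matrix (Σ p : Σ n : Fin l, Fin (m n), Fin ((p.1 : ℕ) + 1))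
      (Σ p : Σ n : Fin l, Fin (m n), Fin ((p.1 : ℕ) + 1)) L}
    (hu : IsUnit A) (hs : Aᵀ = A)
    (hA : A * jordanNilMatrix L l m = -((jordanNilMatrix L l m)ᵀ * A))
    (n : Fin l) (hn : Even ((n : ℕ) + 1)) : Even (m n) := by
  have hdet := (isUnit_iff_isUnit_det A).mp hu
  have hC : jordanNilMatrix L l m * A⁻¹ = -(A⁻¹ * (jordanNilMatrix L l m)ᵀ) := by
    calc jordanNilMatrix L l m * A⁻¹
        = A⁻¹ * (A * jordanNilMatrix L l m) * A⁻¹ := by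
          rw [← Matrix.mul_assoc, nonsing_inv_mul _ hdet, Matrix.one_mul]
      _ = -(A⁻¹ * (jordanNilMatrix L l m)ᵀ) := by
          rw [hA, Matrix.mul_neg, Matrix.neg_mul, Matrix.mul_assoc, Matrix.mul_assoc,
            mul_nonsing_inv _ hdet, Matrix.mul_one]
  let D : Matrix (Fin (m n)) (Fin (m n)) L := fun a b =>
    A⁻¹ ⟨⟨n, a⟩, 0, n.1.succ_pos⟩ ⟨⟨n, b⟩, n, n.1.lt_succ_self⟩
  let B : Matrix (Fin (m n)) (Fin (m n)) L := fun a b =>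
    A ⟨⟨n, a⟩, n, n.1.lt_succ_self⟩ ⟨⟨n, b⟩, 0, n.1.succ_pos⟩
  have hDB : D * B = 1 := by
    ext a c
    have h := congrFun₂ (nonsing_inv_mul _ hdet)
      (⟨⟨n, a⟩, 0, n.1.succ_pos⟩ : Σ p : Σ n : Fin l, Fin (m n), Fin ((p.1 : ℕ) + 1))
      ⟨⟨n, c⟩, 0, n.1.succ_pos⟩
    rw [mul_apply] at h ⊢
    have h1 : (1 : Matrix (Fin (m n)) (Fin (m n)) L) a c =
        (1 : Matrix (Σ p : Σ n : Fin l, Fin (m n), Fin ((p.1 : ℕ) + 1))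
          (Σ p : Σ n : Fin l, Fin (m n), Fin ((p.1 : ℕ) + 1)) L)
          ⟨⟨n, a⟩, 0, n.1.succ_pos⟩ ⟨⟨n, c⟩, 0, n.1.succ_pos⟩ := by
      by_cases hac : a = c
      · subst hac; simp
      · rw [one_apply_ne hac, one_apply_ne]
        intro h
        simp only [Sigma.mk.injEq] at h
        exact hac (by simpa using h.1)
    rw [h1, ← h]
    refine Fintype.sum_of_injective
      (fun b => (⟨⟨n, b⟩, n, n.1.lt_succ_self⟩ :
        Σ p : Σ n : Fin l, Fin (m n), Fin ((p.1 : ℕ) + 1))) ?_ _ _ ?_ (fun _ => rfl)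
    · intro b b' hb
      simp only [Sigma.mk.injEq] at hb
      simpa using hb.1
    · rintro ⟨⟨n', b⟩, j, hj⟩ hne
      by_cases hjn : (n : ℕ) + 1 ≤ j
      · rw [apply_zero_eq_zero_of_mul_eq_neg_mul_transpose hC _ _ j _ hj hjn, zero_mul]
      · rw [apply_eq_zero_of_anticommuting hA hs _ _ j hj _ ?_, mul_zero]
        by_contra hcon
        dsimp only at hcon hj
        obtain rfl : n = n' := by ext; omega
        obtain rfl : (n : ℕ) = j := by omega
        exact hne ⟨b, rfl⟩
  have hBs : Bᵀ = -B := by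
    ext a b
    have hodd : Odd (n : ℕ) := by
      rw [← Nat.not_even_iff_odd]
      exact fun h => (Nat.even_add_one.mp hn) h
    have h := apply_eq_neg_one_pow_mul_of_anticommuting hA ⟨n, b⟩ ⟨n, a⟩ n
      n.1.lt_succ_self n.1.lt_succ_self
    rw [hodd.neg_one_pow, neg_one_mul] at h
    exact h.trans (congrArg Neg.neg (congrFun₂ hs _ _).symm)
  simpa using even_card_of_isUnit_of_transpose_eq_neg hchar B
    (IsUnit.of_mul_eq_one_right _ hDB) hBs

theorem exists_involutive_sign (L : Type*) [Field L] (n k : ℕ) (h : Odd n → Even k) :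
    ∃ (σ : Fin k → Fin k) (η : Fin k → L), Function.Involutive σ ∧ (∀ a, η a * η a = 1) ∧
      ∀ a, η (σ a) = (-1) ^ n * η a := by
  rcases Nat.even_or_odd n with hn | hn
  · exact ⟨id, 1, fun _ => rfl, by simp, by simp [hn.neg_one_pow]⟩
  · refine ⟨Fin.rev, fun a => if a < a.rev then 1 else -1, Fin.rev_rev, ?_, ?_⟩
    · intro a
      dsimp only
      split_ifs <;> simp
    · intro a
      have hne : (a : ℕ) ≠ a.rev := by
        obtain ⟨r, hr⟩ := h hn
        rw [Fin.val_rev]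
        omega
      dsimp only
      rw [Fin.rev_rev, hn.neg_one_pow]
      rcases lt_or_gt_of_ne hne with h' | h'
      · rw [if_neg (not_lt.mpr (Fin.lt_def.mpr h').le), if_pos (Fin.lt_def.mpr h')]
        simp
      · rw [if_pos (Fin.lt_def.mpr h'), if_neg (not_lt.mpr (Fin.lt_def.mpr h').le)]
        simp

theorem exists_anticommuting_of_even (L : Type*) [Field L] {l : ℕ} {m : Fin l → ℕ}
    (hm : ∀ n : Fin l, Even ((n : ℕ) + 1) → Even (m n)) :
    ∃ A : Matrix (Σ p : Σ n : Fin l, Fin (m n), Fin ((p.1 : ℕ) + 1))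
        (Σ p : Σ n : Fin l, Fin (m n), Fin ((p.1 : ℕ) + 1)) L,
      IsUnit A ∧ Aᵀ = A ∧
        A * jordanNilMatrix L l m = -((jordanNilMatrix L l m)ᵀ * A) := by
  choose σ η hσ hη hησ using fun n : Fin l =>
    exists_involutive_sign L n (m n) fun h => hm n h.add_one
  let τ : (Σ p : Σ n : Fin l, Fin (m n), Fin ((p.1 : ℕ) + 1)) →
      Σ p : Σ n : Fin l, Fin (m n), Fin ((p.1 : ℕ) + 1) :=
    fun x => ⟨⟨x.1.1, σ x.1.1 x.1.2⟩, Fin.rev x.2⟩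
  let ε : (Σ p : Σ n : Fin l, Fin (m n), Fin ((p.1 : ℕ) + 1)) → L :=
    fun x => (-1) ^ (x.2 : ℕ) * η x.1.1 x.1.2
  have hτ : ∀ x, τ (τ x) = x := by
    rintro ⟨⟨n, a⟩, i⟩
    simp only [τ]
    rw [Fin.rev_rev]
    have h := hσ n a
    generalize hb : σ n (σ n a) = b at h ⊢
    subst h
    rfl
  have hετ : ∀ x, ε (τ x) = ε x := by
    rintro ⟨⟨n, a⟩, i⟩
    obtain ⟨i, hi⟩ := i
    simp only [τ, ε, Fin.val_rev, hησ]
    dsimp only at hi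
    obtain ⟨k, hk⟩ : ∃ k, (n : ℕ) = i + k := ⟨n - i, by omega⟩
    rw [show (n : ℕ) + 1 - (i + 1) = k by omega, hk, pow_add]
    have h1 : ((-1 : L) ^ k) * (-1) ^ k = 1 := by rw [← mul_pow]; simp
    linear_combination ((-1 : L) ^ i * η n a) * h1
  have hεε : ∀ x, ε x * ε x = 1 := by
    rintro ⟨⟨n, a⟩, i⟩
    simp only [ε]
    rw [mul_mul_mul_comm, hη, ← mul_pow]
    simp
  have hτ_iff : ∀ x y, y = τ x ↔ x = τ y := fun x y =>
    ⟨fun h => by rw [h, hτ], fun h => by rw [h, hτ]⟩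
  let A : Matrix (Σ p : Σ n : Fin l, Fin (m n), Fin ((p.1 : ℕ) + 1))
      (Σ p : Σ n : Fin l, Fin (m n), Fin ((p.1 : ℕ) + 1)) L :=
    fun x y => if y = τ x then ε x else 0
  have hA : ∀ x y, A x y = if y = τ x then ε x else 0 := fun _ _ => rfl
  have hmul : ∀ (M : Matrix (Σ p : Σ n : Fin l, Fin (m n), Fin ((p.1 : ℕ) + 1))
      (Σ p : Σ n : Fin l, Fin (m n), Fin ((p.1 : ℕ) + 1)) L) x y, (A * M) x y = ε x * M (τ x) y := by
    intro M x y
    simp [mul_apply, hA]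
  have hs : Aᵀ = A := by
    ext x y
    simp only [transpose_apply, hA, hτ_iff y x]
    split_ifs with h
    · rw [h, hετ]
    · rfl
  refine ⟨A, ?_, hs, ?_⟩
  · refine IsUnit.of_mul_eq_one A ?_
    ext x y
    rw [hmul, hA]
    simp only [hτ, hετ, one_apply, @eq_comm _ y x]
    split_ifs
    · exact hεε x
    · simp
  · ext x y
    have hr : ((jordanNilMatrix L l m)ᵀ * A) x y = ε y * jordanNilMatrix L l m (τ y) x := by
      rw [← hmul, ← hs, ← transpose_mul, hs, transpose_apply]
    rw [hmul, Matrix.neg_apply, hr]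
    unfold jordanNilMatrix
    rw [blockDiagonal'_jordanNilBlock_apply (d := fun p : Σ n : Fin l, Fin (m n) => (p.1 : ℕ) + 1),
      blockDiagonal'_jordanNilBlock_apply (d := fun p : Σ n : Fin l, Fin (m n) => (p.1 : ℕ) + 1)]
    obtain ⟨⟨n, a⟩, i, hi⟩ := x
    obtain ⟨⟨n', b⟩, j, hj⟩ := y
    dsimp only at hi hj
    by_cases hn : n = n'
    · subst hn
      by_cases hab : σ n a = b
      · subst hab
        simp only [τ, ε, hσ n a, Fin.val_rev, hησ, true_and]
        by_cases hij : i + j = n + 1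
        · rw [if_pos (by omega), if_pos (by omega)]
          have h1 : (-1 : L) ^ j * (-1) ^ (n : ℕ) = -(-1) ^ i := by
            rw [← pow_add, show j + (n : ℕ) = i + 2 * (j - 1) + 1 by omega, pow_succ, pow_add,
              pow_mul]
            simp
          linear_combination (η n a) * h1
        · rw [if_neg (by omega), if_neg (by omega)]
          simp
      · have hba : ¬ σ n b = a := fun h => hab (by rw [← h, hσ n b])
        simp [τ, hab, hba]
    · have hn' : ¬ n' = n := fun h => hn h.symm
      simp [τ, hn, hn']

/-- Let `L` be a field of characteristic `≠ 2` and let `N = N(m_1, …, m_l)` be the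
block-diagonal nilpotent matrix with `m_n` copies of the Jordan block `N_n` for
`1 ≤ n ≤ l`.  Then there exists an invertible symmetric matrix `A` over `L` with
`A * N = -(Nᵀ * A)` if and only if `m_n` is even for every even `n` with
`1 ≤ n ≤ l`. -/
theorem exists_invertible_symmetric_anticommuting_iff
    {L : Type*} [Field L] (hchar : ringChar L ≠ 2) (l : ℕ) (m : Fin l → ℕ) :
    (∃ A : Matrix (Σ p : Σ n : Fin l, Fin (m n), Fin ((p.1 : ℕ) + 1))
             (Σ p : Σ n : Fin l, Fin (m n), Fin ((p.1 : ℕ) + 1)) L,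
        IsUnit A ∧ Aᵀ = A ∧
          A * jordanNilMatrix L l m = -((jordanNilMatrix L l m)ᵀ * A)) ↔
      ∀ n : Fin l, Even ((n : ℕ) + 1) → Even (m n) :=
  ⟨fun ⟨_, hu, hs, hA⟩ n hn => even_of_anticommuting hchar hu hs hA n hn,
    exists_anticommuting_of_even L⟩
end

section
/- Let R be a ring, let M and M' be R-modules with nilpotent R-linear endomorphisms N : M → M and N' : M' → M', and let (W_j) and (W'_j) be their monodromy filtrations. If f : M → M' is an R-linear map satisfying f ∘ N = N' ∘ f, then f is compatible with the monodromy filtrations: f(W_j) ⊆ W'_j for all j ∈ ℤ. -/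
/-- `W` is a monodromy filtration for a nilpotent endomorphism `N` of an
`R`-module `M`: an increasing filtration by submodules, equal to `⊥` for
sufficiently small indices and to `⊤` for sufficiently large indices, satisfying
`N (W j) ⊆ W (j - 2)`, and such that for every `k ≥ 0` the map
`W k / W (k-1) → W (-k) / W (-k-1)` induced by `N ^ k` is an isomorphism
(expressed elementwise: it is injective and surjective). -/
def IsMonodromyFiltration {R M : Type*} [Ring R] [AddCommGroup M] [Module R M]
    (N : Module.End R M) (W : ℤ → Submodule R M) : Prop :=
  Monotone W ∧
  (∃ a : ℤ, ∀ j ≤ a, W j = ⊥) ∧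
  (∃ b : ℤ, ∀ j, b ≤ j → W j = ⊤) ∧
  (∀ j : ℤ, ∀ x ∈ W j, N x ∈ W (j - 2)) ∧
  (∀ k : ℕ, ∀ x ∈ W (k : ℤ), (N ^ k) x ∈ W (-(k : ℤ) - 1) → x ∈ W ((k : ℤ) - 1)) ∧
  (∀ k : ℕ, ∀ y ∈ W (-(k : ℤ)), ∃ x ∈ W (k : ℤ), y - (N ^ k) x ∈ W (-(k : ℤ) - 1))

namespace IsMonodromyFiltration

variable {R M : Type*} [Ring R] [AddCommGroup M] [Module R M]
  {N : Module.End R M} {W : ℤ → Submodule R M}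

theorem pow_apply_mem (hW : IsMonodromyFiltration N W) (m : ℕ) {j : ℤ} {x : M}
    (hx : x ∈ W j) : (N ^ m) x ∈ W (j - 2 * m) := by
  obtain ⟨-, -, -, hshift, -, -⟩ := hW
  induction m with
  | zero => simpa using hx
  | succ m ih =>
    rw [pow_succ', Module.End.mul_apply]
    convert hshift _ _ ih using 2
    push_cast
    ring

theorem mem_of_pow_apply_eq_zero (hW : IsMonodromyFiltration N W) {m : ℕ} {x : M}
    (hx : (N ^ (m + 1)) x = 0) : x ∈ W m := by
  obtain ⟨-, -, ⟨b, hb⟩, -, hinj, -⟩ := hW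
  have descend : ∀ d : ℕ, x ∈ W ((m + d : ℕ) : ℤ) → x ∈ W m := by
    intro d
    induction d with
    | zero => exact fun h => h
    | succ d ih =>
      intro h
      have hzero : (N ^ (m + (d + 1))) x = 0 := by
        rw [show m + (d + 1) = d + (m + 1) by ring, pow_add, Module.End.mul_apply, hx, map_zero]
      apply ih
      convert hinj _ x h (hzero ▸ Submodule.zero_mem _) using 2
      push_cast
      ring
  apply descend b.toNat
  rw [hb _ (by omega)]
  exact Submodule.mem_top

theorem exists_pow_apply_eq (hW : IsMonodromyFiltration N W) {m : ℕ} {y : M}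
    (hy : y ∈ W (-(m : ℤ))) : ∃ x ∈ W m, (N ^ m) x = y := by
  obtain ⟨hmono, ⟨a, ha⟩, -, hshift, -, hsurj⟩ := hW
  have descend : ∀ d m : ℕ, -a ≤ m + d → ∀ y ∈ W (-(m : ℤ)), ∃ x ∈ W m, (N ^ m) x = y := by
    intro d
    induction d with
    | zero =>
      intro m hm y hy
      rw [ha _ (by omega), Submodule.mem_bot] at hy
      exact ⟨0, Submodule.zero_mem _, by simp [hy]⟩
    | succ d ih =>
      intro m hm y hy
      obtain ⟨x, hx, hxy⟩ := hsurj m y hy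
      rw [show -(m : ℤ) - 1 = -((m + 1 : ℕ) : ℤ) by push_cast; ring] at hxy
      obtain ⟨z, hz, hzy⟩ := ih (m + 1) (by push_cast at hm ⊢; linarith) _ hxy
      refine ⟨x + N z, Submodule.add_mem _ hx (hmono (by push_cast; linarith) (hshift _ z hz)), ?_⟩
      rw [pow_succ, Module.End.mul_apply] at hzy
      rw [map_add, hzy, add_sub_cancel]
  exact descend (-a).toNat m (by omega) y hy

theorem exists_pow_apply_sub_eq_zero (hW : IsMonodromyFiltration N W) {m : ℕ} {x : M}
    (hx : x ∈ W m) : ∃ y ∈ W ((m + 2 : ℕ) : ℤ), (N ^ (m + 1)) (x - N y) = 0 := by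
  have h : (N ^ (m + 1)) x ∈ W (-((m + 2 : ℕ) : ℤ)) := by
    convert hW.pow_apply_mem (m + 1) hx using 2
    push_cast
    ring
  obtain ⟨y, hy, hyx⟩ := hW.exists_pow_apply_eq h
  refine ⟨y, hy, ?_⟩
  rw [pow_succ, Module.End.mul_apply] at hyx
  rw [map_sub, hyx, sub_self]

end IsMonodromyFiltration

/-- Let `M, M'` be `R`-modules with nilpotent endomorphisms `N, N'` and monodromy
filtrations `W, W'`.  Every `R`-linear map `f : M → M'` with `f ∘ N = N' ∘ f` is
compatible with the monodromy filtrations: `f (W j) ⊆ W' j` for all `j`. -/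
theorem monodromyFiltration_map_le {R M M' : Type*} [Ring R]
    [AddCommGroup M] [Module R M] [AddCommGroup M'] [Module R M']
    (N : Module.End R M) (N' : Module.End R M')
    (hN : IsNilpotent N) (hN' : IsNilpotent N')
    (W : ℤ → Submodule R M) (W' : ℤ → Submodule R M')
    (hW : IsMonodromyFiltration N W) (hW' : IsMonodromyFiltration N' W')
    (f : M →ₗ[R] M') (hf : f ∘ₗ (N : M →ₗ[R] M) = (N' : M' →ₗ[R] M') ∘ₗ f) :
    ∀ j : ℤ, ∀ x ∈ W j, f x ∈ W' j := by
  have hcomm (m : ℕ) (x : M) : f ((N ^ m) x) = (N' ^ m) (f x) := by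
    induction m with
    | zero => simp
    | succ m ih =>
      rw [pow_succ', pow_succ', Module.End.mul_apply, Module.End.mul_apply, ← ih]
      exact LinearMap.congr_fun hf _
  have hker (m : ℕ) (x : M) (hx : (N ^ (m + 1)) x = 0) : f x ∈ W' m :=
    hW'.mem_of_pow_apply_eq_zero (by rw [← hcomm, hx, map_zero])
  obtain ⟨n, hn⟩ := hN
  have hdescend : ∀ d m : ℕ, n ≤ m + d → ∀ x ∈ W m, f x ∈ W' m := by
    intro d
    induction d with
    | zero =>
      intro m hm x _
      exact hker m x (by rw [pow_eq_zero_of_le (by omega) hn, LinearMap.zero_apply])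
    | succ d ih =>
      intro m hm x hx
      obtain ⟨y, hy, hxy⟩ := hW.exists_pow_apply_sub_eq_zero hx
      have hNy : f (N y) ∈ W' m := by
        have h := hW'.pow_apply_mem 1 (ih (m + 2) (by omega) y hy)
        rw [← hcomm, pow_one] at h
        convert h using 2
        push_cast
        ring
      simpa using Submodule.add_mem _ (hker m _ hxy) hNy
  have hnonneg (m : ℕ) (x : M) (hx : x ∈ W m) : f x ∈ W' m :=
    hdescend n m (by omega) x hx
  intro j x hx
  obtain ⟨m, rfl | rfl⟩ := j.eq_nat_or_neg
  · exact hnonneg m x hx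
  · obtain ⟨y, hy, hyx⟩ := hW.exists_pow_apply_eq hx
    rw [← hyx, hcomm]
    convert hW'.pow_apply_mem m (hnonneg m y hy) using 2
    ring
end
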